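/- arXiv:math/0404041 — 4 statements merged into one kernel-verified Lean document; each statement's English description precedes it below -/
import Mathlib

section
/- Suppose R is nonsingular and p ∈ Δ has p_i > 0 for all i and N_i(p) = λ for every i (a common value λ; equivalently p is an interior critical point, and then λ = H(p) > 0). Then there exists v ∈ Δ with H(v) > H(p) if and only if R, as a real symmetric matrix, has at least two positive eigenvalues counted with multiplicity; equivalently, H attains a strict maximum over Δ at p if and only if R has exactly one positive eigenvalue counted with multiplicity. -/
open MeasureTheory Filter Finset

namespace VRRW

noncomputable def simplex (d : ℕ) : Set (Fin d → ℝ) :=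
  {v | (∀ i, 0 ≤ v i) ∧ ∑ i, v i = 1}

noncomputable def Nvec {d : ℕ} (R : Matrix (Fin d) (Fin d) ℝ) (v : Fin d → ℝ) (i : Fin d) : ℝ :=
  ∑ j, R i j * v j

noncomputable def Hfun {d : ℕ} (R : Matrix (Fin d) (Fin d) ℝ) (v : Fin d → ℝ) : ℝ :=
  ∑ i, ∑ j, R i j * v i * v j

noncomputable def piVec {d : ℕ} (R : Matrix (Fin d) (Fin d) ℝ) (v : Fin d → ℝ) : Fin d → ℝ :=
  fun i => v i * Nvec R v i / Hfun R v

noncomputable def Mmat {d : ℕ} (R : Matrix (Fin d) (Fin d) ℝ) (v : Fin d → ℝ) :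
    Matrix (Fin d) (Fin d) ℝ :=
  fun i j => R i j * v j / Nvec R v i

noncomputable def critSet {d : ℕ} (R : Matrix (Fin d) (Fin d) ℝ) : Set (Fin d → ℝ) :=
  {v | v ∈ simplex d ∧ 0 < Hfun R v ∧ piVec R v = v}

noncomputable def degenSet {d : ℕ} (R : Matrix (Fin d) (Fin d) ℝ) : Set (Fin d → ℝ) :=
  {v | v ∈ simplex d ∧ ((∃ i, Nvec R v i = 0) ∨ ∃ i j, ∀ k, 1 ≤ k → (Mmat R v ^ k) i j = 0)}

/-- `S_i(n)`: one plus the number of visits to state `i` strictly after time `d`, up to time `n`. -/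
noncomputable def visits {d : ℕ} {Ω : Type*} (Y : ℕ → Ω → Fin d) (n : ℕ) (ω : Ω) (i : Fin d) : ℝ :=
  1 + (((Finset.Ioc d n).filter fun m => Y m ω = i).card : ℝ)

/-- `V(n) = S(n)/n`, the fractional occupation vector. -/
noncomputable def occup {d : ℕ} {Ω : Type*} (Y : ℕ → Ω → Fin d) (n : ℕ) (ω : Ω) : Fin d → ℝ :=
  fun i => visits Y n ω i / n

/-- The natural filtration `F_n = σ(Y_d, …, Y_n)`. -/
def natFilt {d : ℕ} {Ω : Type*} (Y : ℕ → Ω → Fin d) (n : ℕ) : MeasurableSpace Ω :=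
  ⨆ m ∈ Finset.Icc d n, MeasurableSpace.comap (Y m) ⊤

/-- The defining properties of the vertex-reinforced random walk driven by `R`:
measurability, start `Y_d = 1` (state `1` is encoded as index `0` of `Fin d`), and the
reinforced transition probabilities, expressed via conditional expectation of indicators. -/
def IsVRRW {d : ℕ} {Ω : Type*} [MeasurableSpace Ω] (μ : Measure Ω)
    (R : Matrix (Fin d) (Fin d) ℝ) (Y : ℕ → Ω → Fin d) : Prop :=
  (∀ n, Measurable (Y n)) ∧
  (∀ ω, (Y d ω : ℕ) = 0) ∧
  (∀ n, d ≤ n → ∀ j : Fin d,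
    (μ[(fun ω => if Y (n + 1) ω = j then (1 : ℝ) else 0) | natFilt Y n])
      =ᵐ[μ] fun ω => R (Y n ω) j * visits Y n ω j / ∑ i, R (Y n ω) i * visits Y n ω i)

/-- Euclidean distance from a point to a set: `inf {|x − y| : y ∈ A}`. -/
noncomputable def distToSet {d : ℕ} (x : Fin d → ℝ) (A : Set (Fin d → ℝ)) : ℝ :=
  sInf ((fun y => Real.sqrt (∑ i, (x i - y i) ^ 2)) '' A)

end VRRW

open VRRW Finset

namespace VRRW

open Matrix

section Spectral

variable {n : Type*} [Fintype n] [DecidableEq n] {A : Matrix n n ℝ}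

/-- The coordinate of `x` along the `i`-th vector of the eigenbasis of `A`. -/
noncomputable def eigenCoord (hA : A.IsHermitian) (x : n → ℝ) (i : n) : ℝ :=
  (hA.eigenvectorBasis i).ofLp ⬝ᵥ x

theorem eigenCoord_sub_smul (hA : A.IsHermitian) (x y : n → ℝ) (c : ℝ) (i : n) :
    eigenCoord hA (x - c • y) i = eigenCoord hA x i - c * eigenCoord hA y i := by
  simp [eigenCoord, dotProduct_sub]

theorem sum_eigenCoord_mul_eigenCoord (hA : A.IsHermitian) (x y : n → ℝ) :
    ∑ i, eigenCoord hA x i * eigenCoord hA y i = x ⬝ᵥ y := by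
  have h := hA.eigenvectorBasis.sum_inner_mul_inner (WithLp.toLp 2 x) (WithLp.toLp 2 y)
  simpa [eigenCoord, EuclideanSpace.inner_eq_star_dotProduct, dotProduct_comm] using h

theorem eigenCoord_mulVec (hA : A.IsHermitian) (x : n → ℝ) (i : n) :
    eigenCoord hA (A *ᵥ x) i = hA.eigenvalues i * eigenCoord hA x i := by
  have hT : Aᵀ = A := by simpa using hA.eq
  rw [eigenCoord, dotProduct_mulVec, ← mulVec_transpose, hT, hA.mulVec_eigenvectorBasis,
    smul_dotProduct, smul_eq_mul, eigenCoord]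

theorem dotProduct_mulVec_eq_sum_eigenvalues (hA : A.IsHermitian) (x : n → ℝ) :
    x ⬝ᵥ A *ᵥ x = ∑ i, hA.eigenvalues i * eigenCoord hA x i ^ 2 := by
  rw [← sum_eigenCoord_mul_eigenCoord hA]
  refine sum_congr rfl fun i _ => ?_
  rw [eigenCoord_mulVec]
  ring

theorem eq_zero_of_eigenCoord_eq_zero (hA : A.IsHermitian) {x : n → ℝ}
    (h : ∀ i, eigenCoord hA x i = 0) : x = 0 := by
  rw [← dotProduct_self_eq_zero, ← sum_eigenCoord_mul_eigenCoord hA]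
  simp [h]

theorem eigenvalues_ne_zero_of_isUnit_det (hA : A.IsHermitian) (hdet : IsUnit A.det) (i : n) :
    hA.eigenvalues i ≠ 0 := by
  intro h
  refine hdet.ne_zero ?_
  rw [hA.det_eq_prod_eigenvalues]
  exact prod_eq_zero (mem_univ i) (by simp [h])

theorem exists_eigenvalue_pos (hA : A.IsHermitian) {x : n → ℝ} (hx : 0 < x ⬝ᵥ A *ᵥ x) :
    ∃ i, 0 < hA.eigenvalues i := by
  by_contra! h
  rw [dotProduct_mulVec_eq_sum_eigenvalues hA] at hx
  exact hx.not_ge (sum_nonpos fun i _ => mul_nonpos_of_nonpos_of_nonneg (h i) (sq_nonneg _))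

/-- If all eigenvalues but one are negative, the quadratic form is negative definite on the
orthogonal complement of the remaining eigenvector. -/
theorem eq_zero_of_eigenCoord_eq_zero_of_nonneg (hA : A.IsHermitian) {k : n}
    (hneg : ∀ i, i ≠ k → hA.eigenvalues i < 0) {x : n → ℝ} (hk : eigenCoord hA x k = 0)
    (hx : 0 ≤ x ⬝ᵥ A *ᵥ x) : x = 0 := by
  have hle : ∀ i ∈ univ, hA.eigenvalues i * eigenCoord hA x i ^ 2 ≤ 0 := by
    intro i _
    by_cases hik : i = k
    · simp [hik, hk]
    · exact mul_nonpos_of_nonpos_of_nonneg (hneg i hik).le (sq_nonneg _)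
  rw [dotProduct_mulVec_eq_sum_eigenvalues hA] at hx
  have hzero := (sum_eq_zero_iff_of_nonpos hle).1 ((sum_nonpos hle).antisymm hx)
  refine eq_zero_of_eigenCoord_eq_zero hA fun i => ?_
  by_cases hik : i = k
  · rw [hik, hk]
  · simpa [(hneg i hik).ne] using hzero i (mem_univ i)

/-- A form with two positive eigenvalues is positive somewhere on every hyperplane. -/
theorem exists_dotProduct_eq_zero_pos (hA : A.IsHermitian) {i j : n} (hij : i ≠ j)
    (hi : 0 < hA.eigenvalues i) (hj : 0 < hA.eigenvalues j) (w : n → ℝ) :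
    ∃ x : n → ℝ, w ⬝ᵥ x = 0 ∧ 0 < x ⬝ᵥ A *ᵥ x := by
  set e : n → n → ℝ := fun k => (hA.eigenvectorBasis k).ofLp with he
  have hee : ∀ k l, e k ⬝ᵥ e l = if k = l then 1 else 0 := by
    intro k l
    have := orthonormal_iff_ite.1 hA.eigenvectorBasis.orthonormal k l
    simpa [he, EuclideanSpace.inner_eq_star_dotProduct, dotProduct_comm] using this
  have hform : ∀ a b : ℝ, (a • e i + b • e j) ⬝ᵥ A *ᵥ (a • e i + b • e j) =
      a ^ 2 * hA.eigenvalues i + b ^ 2 * hA.eigenvalues j := by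
    intro a b
    have hAe : ∀ k, A *ᵥ e k = hA.eigenvalues k • e k := hA.mulVec_eigenvectorBasis
    simp only [mulVec_add, mulVec_smul, hAe, add_dotProduct, dotProduct_add, smul_dotProduct,
      dotProduct_smul, hee, smul_eq_mul, if_neg hij, if_neg hij.symm, if_true]
    ring
  by_cases h : w ⬝ᵥ e i = 0
  · refine ⟨(1 : ℝ) • e i + (0 : ℝ) • e j, by simp [h], ?_⟩
    rw [hform]
    simpa using hi
  · refine ⟨(w ⬝ᵥ e j) • e i + (-(w ⬝ᵥ e i)) • e j, ?_, ?_⟩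
    · simp only [dotProduct_add, dotProduct_smul, smul_eq_mul]
      ring
    · rw [hform]
      have : 0 < (-(w ⬝ᵥ e i)) ^ 2 := sq_pos_iff.2 (neg_ne_zero.2 h)
      positivity

end Spectral

variable {d : ℕ} {R : Matrix (Fin d) (Fin d) ℝ}

theorem Hfun_eq_dotProduct (R : Matrix (Fin d) (Fin d) ℝ) (v : Fin d → ℝ) :
    Hfun R v = v ⬝ᵥ R *ᵥ v := by
  simp only [Hfun, dotProduct, mulVec, mul_sum]
  exact sum_congr rfl fun i _ => sum_congr rfl fun j _ => by ring

theorem dotProduct_mulVec_of_Nvec_eq {p : Fin d → ℝ} {lam : ℝ} (hlam : ∀ i, Nvec R p i = lam)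
    (x : Fin d → ℝ) : x ⬝ᵥ R *ᵥ p = lam * ∑ i, x i := by
  have h : ∀ i, (R *ᵥ p) i = lam := hlam
  simp only [dotProduct, h, mul_sum, mul_comm]

/-- At a point where `Nvec` is constant, the second-order expansion of `Hfun`. -/
theorem Hfun_add_smul (hR : R.IsHermitian) {p : Fin d → ℝ} {lam : ℝ}
    (hlam : ∀ i, Nvec R p i = lam) (x : Fin d → ℝ) (c : ℝ) :
    Hfun R (x + c • p) = Hfun R x + 2 * c * (lam * ∑ i, x i) + c ^ 2 * Hfun R p := by
  have hsymm : p ⬝ᵥ R *ᵥ x = x ⬝ᵥ R *ᵥ p := by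
    have hT : Rᵀ = R := by simpa using hR.eq
    rw [dotProduct_mulVec, ← mulVec_transpose, hT, dotProduct_comm]
  simp only [Hfun_eq_dotProduct, mulVec_add, mulVec_smul, add_dotProduct, dotProduct_add,
    smul_dotProduct, dotProduct_smul, smul_eq_mul, hsymm, dotProduct_mulVec_of_Nvec_eq hlam x]
  ring

theorem Hfun_smul (R : Matrix (Fin d) (Fin d) ℝ) (x : Fin d → ℝ) (c : ℝ) :
    Hfun R (c • x) = c ^ 2 * Hfun R x := by
  simp only [Hfun_eq_dotProduct, mulVec_smul, smul_dotProduct, dotProduct_smul, smul_eq_mul]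
  ring

theorem Hfun_pos (hd : 0 < d) (hnonneg : ∀ i j, 0 ≤ R i j) (hcol : ∀ j, 0 < ∑ i, R i j)
    {p : Fin d → ℝ} (hppos : ∀ i, 0 < p i) : 0 < Hfun R p := by
  have hterm : ∀ i j, 0 ≤ R i j * p i * p j := fun i j =>
    mul_nonneg (mul_nonneg (hnonneg i j) (hppos i).le) (hppos j).le
  obtain ⟨i, -, hi⟩ := exists_lt_of_sum_lt (s := univ) (f := fun _ => (0 : ℝ))
    (g := fun i => R i ⟨0, hd⟩) (by simpa using hcol ⟨0, hd⟩)
  exact sum_pos' (fun i _ => sum_nonneg fun j _ => hterm i j) ⟨i, mem_univ i,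
    sum_pos' (fun j _ => hterm i j)
      ⟨⟨0, hd⟩, mem_univ _, mul_pos (mul_pos hi (hppos i)) (hppos _)⟩⟩

/-- With a single positive eigenvalue, `Hfun` is negative on nonzero vectors of zero sum. -/
theorem Hfun_neg_of_sum_eq_zero (hR : R.IsHermitian) {p : Fin d → ℝ} {lam : ℝ}
    (hlam : ∀ i, Nvec R p i = lam) (hsum : ∑ i, p i = 1) (hH : 0 < Hfun R p) {k : Fin d}
    (hneg : ∀ i, i ≠ k → hR.eigenvalues i < 0) {x : Fin d → ℝ} (hx : x ≠ 0)
    (hx0 : ∑ i, x i = 0) : Hfun R x < 0 := by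
  by_contra! hQ
  have hpk : eigenCoord hR p k ≠ 0 := by
    intro h
    have hp0 := eq_zero_of_eigenCoord_eq_zero_of_nonneg hR hneg h
      (Hfun_eq_dotProduct R p ▸ hH.le)
    simp [hp0] at hsum
  set c := eigenCoord hR x k / eigenCoord hR p k with hc
  have hyk : eigenCoord hR (x - c • p) k = 0 := by
    rw [eigenCoord_sub_smul, hc, div_mul_cancel₀ _ hpk, sub_self]
  have hy : x - c • p = 0 := by
    refine eq_zero_of_eigenCoord_eq_zero_of_nonneg hR hneg hyk ?_
    rw [← Hfun_eq_dotProduct, sub_eq_add_neg, ← neg_smul, Hfun_add_smul hR hlam, hx0]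
    have := mul_nonneg (sq_nonneg (-c)) hH.le
    linarith
  have hc0 : c = 0 := by
    have := congrArg (fun f : Fin d → ℝ => ∑ i, f i) hy
    simpa [sum_sub_distrib, ← mul_sum, hx0, hsum] using this
  exact hx (by simpa [hc0] using hy)

/-- An interior point of the simplex can be moved slightly in any direction of zero sum. -/
theorem exists_pos_smul_add_mem_simplex {p : Fin d → ℝ} (hsum : ∑ i, p i = 1)
    (hppos : ∀ i, 0 < p i) {x : Fin d → ℝ} (hx0 : ∑ i, x i = 0) :
    ∃ c : ℝ, 0 < c ∧ c • x + p ∈ simplex d := by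
  have hev : ∀ i, ∀ᶠ c : ℝ in nhdsWithin 0 (Set.Ioi 0), 0 < c * x i + p i := by
    intro i
    have hcont : ContinuousAt (fun c : ℝ => c * x i + p i) 0 := by fun_prop
    exact (hcont.eventually_const_lt (by simpa using hppos i)).filter_mono nhdsWithin_le_nhds
  obtain ⟨c, hc, hc0⟩ := ((eventually_all.2 hev).and self_mem_nhdsWithin).exists
  refine ⟨c, hc0, fun i => by simpa using (hc i).le, ?_⟩
  simp [sum_add_distrib, ← mul_sum, hx0, hsum]

end VRRW

/-- For an interior critical point `p` of a nonsingular symmetric `R`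
(with common value `λ` of the `N_i`), `H` fails to be maximized at `p` iff `R` has at least
two positive eigenvalues (with multiplicity); equivalently, `H` has a strict maximum at `p`
over `Δ` iff `R` has exactly one positive eigenvalue (with multiplicity). -/
theorem stmt11 {d : ℕ} (hd : 2 ≤ d) (R : Matrix (Fin d) (Fin d) ℝ)
    (hherm : R.IsHermitian) (hnonneg : ∀ i j, 0 ≤ R i j) (hcol : ∀ j, 0 < ∑ i, R i j)
    (hdet : IsUnit R.det)
    (p : Fin d → ℝ) (hp : p ∈ simplex d) (hppos : ∀ i, 0 < p i)
    (lam : ℝ) (hlam : ∀ i, Nvec R p i = lam) :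
    ((∃ v ∈ simplex d, Hfun R p < Hfun R v) ↔
      2 ≤ (Finset.univ.filter fun i => 0 < hherm.eigenvalues i).card) ∧
    ((∀ v ∈ simplex d, v ≠ p → Hfun R v < Hfun R p) ↔
      (Finset.univ.filter fun i => 0 < hherm.eigenvalues i).card = 1) := by
  obtain ⟨-, hsum⟩ := hp
  have hH : 0 < Hfun R p := Hfun_pos (by lia) hnonneg hcol hppos
  set S := Finset.univ.filter fun i => 0 < hherm.eigenvalues i with hS
  have hcard : 1 ≤ S.card := by
    obtain ⟨k, hk⟩ := exists_eigenvalue_pos hherm (Hfun_eq_dotProduct R p ▸ hH)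
    exact card_pos.2 ⟨k, by simpa [hS] using hk⟩
  have hstrict : S.card = 1 → ∀ v ∈ simplex d, v ≠ p → Hfun R v < Hfun R p := by
    intro h v hv hvp
    obtain ⟨k, hk⟩ := card_eq_one.1 h
    have hneg : ∀ i, i ≠ k → hherm.eigenvalues i < 0 := by
      intro i hik
      refine (eigenvalues_ne_zero_of_isUnit_det hherm hdet i).lt_of_le (not_lt.1 fun hi => hik ?_)
      have : i ∈ S := by simpa [hS] using hi
      simpa [hk] using this
    have hx0 : ∑ i, (v - p) i = 0 := by simp [sum_sub_distrib, hv.2, hsum]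
    have hlt := Hfun_neg_of_sum_eq_zero hherm hlam hsum hH hneg (sub_ne_zero.2 hvp) hx0
    have hexp := Hfun_add_smul hherm hlam (v - p) 1
    rw [one_smul, sub_add_cancel, hx0] at hexp
    linarith
  have hgain : 2 ≤ S.card → ∃ v ∈ simplex d, Hfun R p < Hfun R v := by
    intro h
    obtain ⟨i, hi, j, hj, hij⟩ := one_lt_card.1 h
    obtain ⟨x, hx, hpos⟩ := exists_dotProduct_eq_zero_pos hherm hij
      (by simpa [hS] using hi) (by simpa [hS] using hj) 1
    rw [one_dotProduct] at hx
    rw [← Hfun_eq_dotProduct] at hpos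
    obtain ⟨c, hc, hmem⟩ := exists_pos_smul_add_mem_simplex hsum hppos hx
    refine ⟨c • x + p, hmem, ?_⟩
    have hcx : ∑ i, (c • x) i = 0 := by simp [← mul_sum, hx]
    have hexp := Hfun_add_smul hherm hlam (c • x) 1
    rw [one_smul, hcx, Hfun_smul] at hexp
    have : 0 < c ^ 2 * Hfun R x := by positivity
    linarith
  refine ⟨⟨fun ⟨v, hv, hlt⟩ => ?_, hgain⟩, ⟨fun h => ?_, hstrict⟩⟩
  · by_contra hlt2
    have hvp : v ≠ p := fun h => hlt.ne (by rw [h])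
    exact (hstrict (by lia) v hv hvp).not_gt hlt
  · by_contra hne
    obtain ⟨v, hv, hlt⟩ := hgain (by lia)
    exact (h v hv fun hvp => hlt.ne (by rw [hvp])).not_gt hlt
end

section
/- Suppose R is nonsingular and p ∈ Δ has p_i > 0 for all i and N_i(p) = λ for every i (a common value λ > 0). Let W = {w ∈ ℝ^d : Σ_i w_i = 0} and let T̃ be the d×d matrix with entries T̃_{ij} = R_{ij} p_i / λ. Then T̃ maps W into W, and R has at least two positive eigenvalues counted with multiplicity if and only if the restriction of T̃ to W has a positive eigenvalue, i.e. there exist w ∈ W with w ≠ 0 and μ > 0 such that T̃ w = μ w. -/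
open MeasureTheory Filter Finset

open VRRW Finset

open Matrix

section QuadraticForm

variable {n : Type*} [Fintype n] {A : Matrix n n ℝ}

lemma dotProduct_mulVec_comm_of_isHermitian (hA : A.IsHermitian) (x y : n → ℝ) :
    x ⬝ᵥ A *ᵥ y = y ⬝ᵥ A *ᵥ x := by
  have hsymm : Aᵀ = A := by simpa [conjTranspose_eq_transpose_of_trivial] using hA.eq
  rw [dotProduct_mulVec, ← mulVec_transpose, hsymm, dotProduct_comm]

/-- A symmetric form that is positive on two orthogonal vectors is positive somewhere on every
hyperplane. -/
lemma exists_dotProduct_eq_zero_and_form_pos (hA : A.IsHermitian) {x y : n → ℝ}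
    (hx : 0 < x ⬝ᵥ A *ᵥ x) (hy : 0 < y ⬝ᵥ A *ᵥ y) (hxy : x ⬝ᵥ A *ᵥ y = 0) (c : n → ℝ) :
    ∃ z, c ⬝ᵥ z = 0 ∧ 0 < z ⬝ᵥ A *ᵥ z := by
  by_cases hc : c ⬝ᵥ x = 0
  · exact ⟨x, hc, hx⟩
  have hyx : y ⬝ᵥ A *ᵥ x = 0 := by rw [dotProduct_mulVec_comm_of_isHermitian hA, hxy]
  refine ⟨(c ⬝ᵥ y) • x - (c ⬝ᵥ x) • y, ?_, ?_⟩
  · simp only [dotProduct_sub, dotProduct_smul, smul_eq_mul]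
    ring
  · simp only [mulVec_sub, mulVec_smul, dotProduct_sub, sub_dotProduct, dotProduct_smul,
      smul_dotProduct, smul_eq_mul, hxy, hyx]
    have hcx : 0 < (c ⬝ᵥ x) ^ 2 := by positivity
    nlinarith [mul_pos hcx hy, mul_nonneg (sq_nonneg (c ⬝ᵥ y)) hx.le]

variable [DecidableEq n]

lemma form_eq_sum_eigenvalues (hA : A.IsHermitian) (x : n → ℝ) :
    x ⬝ᵥ A *ᵥ x =
      ∑ i, hA.eigenvalues i * ((hA.eigenvectorBasis i).ofLp ⬝ᵥ x) ^ 2 := by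
  have h := hA.eigenvectorBasis.sum_inner_mul_inner (WithLp.toLp 2 x) (WithLp.toLp 2 (A *ᵥ x))
  simp only [EuclideanSpace.inner_eq_star_dotProduct, star_trivial] at h
  rw [dotProduct_comm, ← h]
  refine Finset.sum_congr rfl fun i _ => ?_
  rw [dotProduct_comm (A *ᵥ x), dotProduct_mulVec_comm_of_isHermitian hA,
    hA.mulVec_eigenvectorBasis, dotProduct_smul, smul_eq_mul, dotProduct_comm x]
  ring

lemma exists_eigenvalue_pos_of_form_pos (hA : A.IsHermitian) {x : n → ℝ}
    (hx : 0 < x ⬝ᵥ A *ᵥ x) :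
    ∃ i, 0 < hA.eigenvalues i ∧ (hA.eigenvectorBasis i).ofLp ⬝ᵥ x ≠ 0 := by
  rw [form_eq_sum_eigenvalues hA] at hx
  by_contra! h
  refine hx.not_ge (Finset.sum_nonpos fun i _ => ?_)
  by_cases hi : 0 < hA.eigenvalues i
  · simp [h i hi]
  · exact mul_nonpos_of_nonpos_of_nonneg (not_lt.mp hi) (sq_nonneg _)

lemma eigenvectorBasis_dotProduct (hA : A.IsHermitian) (i j : n) :
    (hA.eigenvectorBasis i).ofLp ⬝ᵥ (hA.eigenvectorBasis j).ofLp = if i = j then 1 else 0 := by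
  have h := orthonormal_iff_ite.mp hA.eigenvectorBasis.orthonormal i j
  rwa [EuclideanSpace.inner_eq_star_dotProduct, star_trivial, dotProduct_comm] at h

lemma two_le_card_eigenvalues_pos_iff (hA : A.IsHermitian) :
    2 ≤ (Finset.univ.filter fun i => 0 < hA.eigenvalues i).card ↔
      ∃ x y, 0 < x ⬝ᵥ A *ᵥ x ∧ 0 < y ⬝ᵥ A *ᵥ y ∧ x ⬝ᵥ A *ᵥ y = 0 := by
  constructor
  · intro h
    obtain ⟨i, hi, j, hj, hij⟩ := Finset.one_lt_card.mp h
    simp only [Finset.mem_filter_univ] at hi hj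
    refine ⟨(hA.eigenvectorBasis i).ofLp, (hA.eigenvectorBasis j).ofLp, ?_, ?_, ?_⟩ <;>
      simp [hA.mulVec_eigenvectorBasis, eigenvectorBasis_dotProduct, hi, hj, hij]
  · rintro ⟨x, y, hx, hy, hxy⟩
    obtain ⟨k, hk, -⟩ := exists_eigenvalue_pos_of_form_pos hA hx
    obtain ⟨z, hkz, hz⟩ :=
      exists_dotProduct_eq_zero_and_form_pos hA hx hy hxy (hA.eigenvectorBasis k).ofLp
    obtain ⟨l, hl, hlz⟩ := exists_eigenvalue_pos_of_form_pos hA hz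
    refine Finset.one_lt_card.mpr ⟨k, by simpa using hk, l, by simpa using hl, ?_⟩
    rintro rfl
    exact hlz hkz

end QuadraticForm

section CriticalPoint

variable {n : Type*} [Fintype n] {R : Matrix n n ℝ} {p : n → ℝ} {lam : ℝ}

/-- If `R *ᵥ p` is constant, positivity of the form of `R` somewhere on the hyperplane of vectors
with zero sum yields an eigenvector of `diagonal p * R` in that hyperplane. -/
lemma exists_eigenvector_of_form_pos (hR : R.IsHermitian) (hp : ∀ i, 0 < p i)
    (hp_sum : ∑ i, p i = 1) (hlam : R *ᵥ p = fun _ => lam) {x : n → ℝ} (hx_sum : ∑ i, x i = 0)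
    (hx : 0 < x ⬝ᵥ R *ᵥ x) :
    ∃ w : n → ℝ, ∑ i, w i = 0 ∧ w ≠ 0 ∧ ∃ m, 0 < m ∧ ∀ i, p i * (R *ᵥ w) i = m * w i := by
  classical
  set q : n → ℝ := fun i => √(p i)
  have hq : ∀ i, 0 < q i := fun i => Real.sqrt_pos.mpr (hp i)
  have hqq : ∀ i, q i * q i = p i := fun i => Real.mul_self_sqrt (hp i).le
  -- Conjugate to a symmetric matrix and remove the eigenvector `q`.
  let S : Matrix n n ℝ := of fun i j => q i * (R i j - lam) * q j
  have hS : S.IsHermitian := by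
    ext i j
    have := hR.apply i j
    simp only [star_trivial] at this
    simp only [conjTranspose_apply, of_apply, S, this, star_trivial]
    ring
  have hS_mulVec (u : n → ℝ) (i : n) :
      (S *ᵥ u) i = q i * ((R *ᵥ fun j => q j * u j) i - lam * ∑ j, q j * u j) := by
    simp only [mulVec, dotProduct, of_apply, S, Finset.mul_sum, ← Finset.sum_sub_distrib]
    exact Finset.sum_congr rfl fun j _ => by ring
  have hS_pos : 0 < (fun i => x i / q i) ⬝ᵥ S *ᵥ fun i => x i / q i := by
    have hqx : (fun i => q i * (x i / q i)) = x := by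
      ext i
      exact mul_div_cancel₀ _ (hq i).ne'
    convert hx using 1
    refine Finset.sum_congr rfl fun i _ => ?_
    rw [hS_mulVec, hqx, hx_sum]
    have := (hq i).ne'
    field_simp
    ring
  obtain ⟨k, hk, -⟩ := exists_eigenvalue_pos_of_form_pos hS hS_pos
  set m := hS.eigenvalues k
  set u := (hS.eigenvectorBasis k).ofLp
  have hu (i : n) : q i * ((R *ᵥ fun j => q j * u j) i - lam * ∑ j, q j * u j) = m * u i := by
    rw [← hS_mulVec, hS.mulVec_eigenvectorBasis]
    rfl
  have hpu (i : n) : p i * (R *ᵥ fun j => q j * u j) i =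
      m * (q i * u i) + p i * (lam * ∑ j, q j * u j) := by
    linear_combination q i * hu i +
      (lam * ∑ j, q j * u j - (R *ᵥ fun j => q j * u j) i) * hqq i
  have hsum : ∑ i, q i * u i = 0 := by
    have h := dotProduct_mulVec_comm_of_isHermitian hR p fun j => q j * u j
    have h₁ : p ⬝ᵥ (R *ᵥ fun j => q j * u j) =
        m * ∑ i, q i * u i + lam * ∑ j, q j * u j := by
      simp only [dotProduct, hpu, Finset.sum_add_distrib, ← Finset.mul_sum, ← Finset.sum_mul,
        hp_sum, one_mul]
    have h₂ : (fun j => q j * u j) ⬝ᵥ R *ᵥ p = lam * ∑ j, q j * u j := by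
      simp only [dotProduct, hlam, ← Finset.sum_mul, mul_comm lam]
    exact (mul_eq_zero.mp (by linarith : m * ∑ i, q i * u i = 0)).resolve_left hk.ne'
  refine ⟨fun i => q i * u i, hsum, fun h => ?_, m, hk, fun i => ?_⟩
  · refine hS.eigenvectorBasis.orthonormal.ne_zero k ?_
    ext i
    exact (mul_eq_zero.mp (congrFun h i)).resolve_left (hq i).ne'
  · rw [hpu, hsum]
    ring

lemma form_pos_of_eigenvector (hp : ∀ i, 0 < p i) {w : n → ℝ} (hw : w ≠ 0) {m : ℝ}
    (hm : 0 < m) (h : ∀ i, p i * (R *ᵥ w) i = m * w i) : 0 < w ⬝ᵥ R *ᵥ w := by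
  have hterm (i : n) : w i * (R *ᵥ w) i = m * w i ^ 2 / p i := by
    rw [eq_div_iff (hp i).ne']
    linear_combination w i * h i
  obtain ⟨i, hi⟩ := Function.ne_iff.mp hw
  simp only [dotProduct, hterm]
  refine Finset.sum_pos' (fun j _ => ?_) ⟨i, Finset.mem_univ i, ?_⟩
  · have := hp j
    positivity
  · have := hp i
    have : w i ≠ 0 := hi
    positivity

end CriticalPoint

/-- With `p` an interior critical point (common value `λ > 0` of the
`N_i`) and `T̃_{ij} = R_{ij} p_i / λ`, the matrix `T̃` maps `W = {w : Σ_i w_i = 0}` into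
itself, and `R` has at least two positive eigenvalues (with multiplicity) iff the
restriction of `T̃` to `W` has a positive eigenvalue. -/
theorem stmt12 {d : ℕ} (hd : 2 ≤ d) (R : Matrix (Fin d) (Fin d) ℝ)
    (hherm : R.IsHermitian) (hnonneg : ∀ i j, 0 ≤ R i j) (hcol : ∀ j, 0 < ∑ i, R i j)
    (hdet : IsUnit R.det)
    (p : Fin d → ℝ) (hp : p ∈ simplex d) (hppos : ∀ i, 0 < p i)
    (lam : ℝ) (hlampos : 0 < lam) (hlam : ∀ i, Nvec R p i = lam)
    (T : Matrix (Fin d) (Fin d) ℝ) (hT : ∀ i j, T i j = R i j * p i / lam) :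
    (∀ w : Fin d → ℝ, ∑ i, w i = 0 → ∑ i, T.mulVec w i = 0) ∧
    (2 ≤ (Finset.univ.filter fun i => 0 < hherm.eigenvalues i).card ↔
      ∃ w : Fin d → ℝ, (∑ i, w i = 0) ∧ w ≠ 0 ∧ ∃ m : ℝ, 0 < m ∧ T.mulVec w = m • w) := by
  have hRp : R *ᵥ p = fun _ => lam := funext hlam
  have hTw (w : Fin d → ℝ) (i : Fin d) : T.mulVec w i = p i * (R *ᵥ w) i / lam := by
    simp only [mulVec, dotProduct, hT, Finset.mul_sum, Finset.sum_div]
    exact Finset.sum_congr rfl fun j _ => by ring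
  have hpw (w : Fin d → ℝ) : p ⬝ᵥ R *ᵥ w = lam * ∑ i, w i := by
    rw [dotProduct_mulVec_comm_of_isHermitian hherm, hRp]
    simp only [dotProduct, ← Finset.sum_mul, mul_comm lam]
  refine ⟨fun w hw => ?_, ?_⟩
  · simp only [hTw, ← Finset.sum_div]
    rw [show ∑ i, p i * (R *ᵥ w) i = p ⬝ᵥ R *ᵥ w from rfl, hpw, hw, mul_zero, zero_div]
  rw [two_le_card_eigenvalues_pos_iff]
  constructor
  · rintro ⟨x, y, hx, hy, hxy⟩
    obtain ⟨z, hz_sum, hz⟩ := exists_dotProduct_eq_zero_and_form_pos hherm hx hy hxy 1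
    rw [one_dotProduct] at hz_sum
    obtain ⟨w, hw_sum, hw, m, hm, h⟩ :=
      exists_eigenvector_of_form_pos hherm hppos hp.2 hRp hz_sum hz
    refine ⟨w, hw_sum, hw, m / lam, by positivity, funext fun i => ?_⟩
    rw [hTw, h, Pi.smul_apply, smul_eq_mul]
    ring
  · rintro ⟨w, hw_sum, hw, m, hm, h⟩
    refine ⟨p, w, ?_, ?_, ?_⟩
    · rw [hpw, hp.2]
      linarith
    · refine form_pos_of_eigenvector hppos hw (mul_pos hm hlampos) fun i => ?_
      have hi := congrFun h i
      rw [hTw, Pi.smul_apply, smul_eq_mul, div_eq_iff hlampos.ne'] at hi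
      rw [hi]
      ring
    · rw [hpw, hw_sum, mul_zero]
end

section
/- Let p ∈ Δ satisfy H(p) > 0 and π(p) = p, let k be an index with p_k = 0, and let b > 0 satisfy Σ_{i : p_i > 0} R_{ki} p_i / N_i(p) = 1 + b. Then there exists ε > 0 such that for every δ > 0, every real n > 0, and all vectors s, s' ∈ ℝ^d with s_i > 0 and s_i ≤ s'_i for all i, Σ_i s_i = n and Σ_i s'_i = n + δn, the two conditions |s/n − p| < ε and (s'_i − s_i)/(δn) ≥ p_i − ε for all i imply Σ_i (s'_i − s_i) R_{ik} (s_k/n) / ((1 + δ) N_i(s/n)) > δ (1 + b/2)/(1 + δ) · s_k. -/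
open MeasureTheory Filter Finset

open VRRW

/-- Off the zero set of `p`, every coordinate of `N(p)` equals `H(p)` at a critical point. -/
lemma Nvec_eq_Hfun_of_piVec_eq {d : ℕ} {R : Matrix (Fin d) (Fin d) ℝ} {p : Fin d → ℝ}
    (hH : 0 < Hfun R p) (hcrit : piVec R p = p) {i : Fin d} (hi : 0 < p i) :
    Nvec R p i = Hfun R p := by
  have h : p i * Nvec R p i / Hfun R p = p i := congrFun hcrit i
  rw [div_eq_iff hH.ne'] at h
  exact mul_left_cancel₀ hi.ne' h

lemma continuous_Nvec {d : ℕ} (R : Matrix (Fin d) (Fin d) ℝ) (i : Fin d) :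
    Continuous fun v => Nvec R v i := by
  unfold Nvec
  fun_prop

lemma Nvec_nonneg {d : ℕ} {R : Matrix (Fin d) (Fin d) ℝ} (hR : ∀ i j, 0 ≤ R i j)
    {v : Fin d → ℝ} (hv : ∀ j, 0 ≤ v j) (i : Fin d) : 0 ≤ Nvec R v i :=
  Finset.sum_nonneg fun j _ => mul_nonneg (hR i j) (hv j)

/-- The sum `∑_{p_i > 0} R_{ki} p_i / N_i(p)` stays close to its value when `N` is evaluated near
`p` and each `p_i` in the numerator is lowered by a small amount. -/
lemma exists_lt_sum_of_dist_lt {d : ℕ} {R : Matrix (Fin d) (Fin d) ℝ} {p : Fin d → ℝ}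
    (hH : 0 < Hfun R p) (hcrit : piVec R p = p) (k : Fin d) {c : ℝ}
    (hc : c < ∑ i, if 0 < p i then R k i * p i / Nvec R p i else 0) :
    ∃ ε : ℝ, 0 < ε ∧ ∀ v : Fin d → ℝ, dist v p < ε →
      c < ∑ i, if 0 < p i then R k i * (p i - ε) / Nvec R v i else 0 := by
  let F : (Fin d → ℝ) × ℝ → ℝ := fun x =>
    ∑ i, if 0 < p i then R k i * (p i - x.2) / Nvec R x.1 i else 0
  have hF : ContinuousAt F (p, 0) := by
    refine tendsto_finsetSum _ fun i _ => ?_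
    by_cases hi : 0 < p i
    · simp only [hi, if_true]
      refine ContinuousAt.div (by fun_prop)
        ((continuous_Nvec R i).comp continuous_fst).continuousAt ?_
      simpa [Nvec_eq_Hfun_of_piVec_eq hH hcrit hi] using hH.ne'
    · simp only [hi, if_false]
      exact tendsto_const_nhds
  have hF0 : c < F (p, 0) := by simpa [F] using hc
  obtain ⟨r, hr, hball⟩ := Metric.eventually_nhds_iff.mp (hF.eventually_const_lt hF0)
  refine ⟨r / 2, half_pos hr, fun v hv => hball (y := (v, r / 2)) ?_⟩
  rw [Prod.dist_eq, max_lt_iff, Real.dist_eq, sub_zero, abs_of_pos (half_pos hr)]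
  exact ⟨hv.trans (half_lt_self hr), half_lt_self hr⟩

lemma dist_le_sqrt_sum_sq {ι : Type*} [Fintype ι] (v w : ι → ℝ) :
    dist v w ≤ Real.sqrt (∑ i, (v i - w i) ^ 2) := by
  refine (dist_pi_le_iff (Real.sqrt_nonneg _)).mpr fun i => ?_
  rw [Real.dist_eq]
  exact Real.abs_le_sqrt
    (Finset.single_le_sum (f := fun j => (v j - w j) ^ 2) (fun j _ => sq_nonneg _)
      (Finset.mem_univ i))

/-- (Proposition `1+b`.)  With `p` a critical point, `p_k = 0` and
`Σ_{i : p_i > 0} R_{ki} p_i / N_i(p) = 1 + b` for some `b > 0`, there is an `ε > 0` such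
that for all `δ > 0`, `n > 0` and strictly positive `s ≤ s'` with `Σ s = n`,
`Σ s' = n + δn`: if `|s/n − p| < ε` (Euclidean) and `(s'_i − s_i)/(δn) ≥ p_i − ε` for all
`i`, then `Σ_i (s'_i − s_i) R_{ik} (s_k/n) / ((1+δ) N_i(s/n)) > δ (1+b/2)/(1+δ) · s_k`. -/
theorem stmt16 {d : ℕ} (hd : 2 ≤ d) (R : Matrix (Fin d) (Fin d) ℝ)
    (hsymm : R.IsSymm) (hnonneg : ∀ i j, 0 ≤ R i j) (hcol : ∀ j, 0 < ∑ i, R i j)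
    (p : Fin d → ℝ) (hp : p ∈ simplex d) (hH : 0 < Hfun R p) (hcrit : piVec R p = p)
    (k : Fin d) (hk : p k = 0) (b : ℝ) (hb : 0 < b)
    (hsum : (∑ i, if 0 < p i then R k i * p i / Nvec R p i else 0) = 1 + b) :
    ∃ ε : ℝ, 0 < ε ∧
      ∀ δ : ℝ, 0 < δ → ∀ n : ℝ, 0 < n → ∀ s s' : Fin d → ℝ,
        (∀ i, 0 < s i) → (∀ i, s i ≤ s' i) →
        (∑ i, s i) = n → (∑ i, s' i) = n + δ * n →
        Real.sqrt (∑ i, (s i / n - p i) ^ 2) < ε →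
        (∀ i, p i - ε ≤ (s' i - s i) / (δ * n)) →
        δ * (1 + b / 2) / (1 + δ) * s k <
          ∑ i, (s' i - s i) * R i k * (s k / n) / ((1 + δ) * Nvec R (fun j => s j / n) i) := by
  obtain ⟨ε, hε, h⟩ := exists_lt_sum_of_dist_lt hH hcrit k (c := 1 + b / 2)
    (by rw [hsum]; linarith)
  refine ⟨ε, hε, fun δ hδ n hn s s' hs hss' _ _ hdist hlow => ?_⟩
  have hN : ∀ i, 0 ≤ Nvec R (fun j => s j / n) i :=
    Nvec_nonneg hnonneg fun j => (div_pos (hs j) hn).le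
  have hlt := h (fun j => s j / n) ((dist_le_sqrt_sum_sq _ _).trans_lt hdist)
  have hle : (∑ i, if 0 < p i then R k i * (p i - ε) / Nvec R (fun j => s j / n) i else 0) ≤
      ∑ i, R k i * ((s' i - s i) / (δ * n)) / Nvec R (fun j => s j / n) i := by
    refine Finset.sum_le_sum fun i _ => ?_
    split_ifs with hi
    · exact div_le_div_of_nonneg_right (mul_le_mul_of_nonneg_left (hlow i) (hnonneg k i)) (hN i)
    · exact div_nonneg (mul_nonneg (hnonneg k i)
        (div_nonneg (sub_nonneg.mpr (hss' i)) (mul_pos hδ hn).le)) (hN i)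
  have hsk := hs k
  have hfac : 0 < δ / (1 + δ) * s k := by positivity
  calc δ * (1 + b / 2) / (1 + δ) * s k = δ / (1 + δ) * s k * (1 + b / 2) := by ring
    _ < δ / (1 + δ) * s k *
        ∑ i, R k i * ((s' i - s i) / (δ * n)) / Nvec R (fun j => s j / n) i :=
      mul_lt_mul_of_pos_left (hlt.trans_le hle) hfac
    _ = _ := by
      rw [Finset.mul_sum]
      refine Finset.sum_congr rfl fun i _ => ?_
      rw [hsymm.apply i k, ← div_div _ (1 + δ)]
      field_simp
end

section
/- Let (F_n)_{n≥1} be a filtration on a probability space and let (S_n)_{n≥1} be an adapted real-valued process with S_n ≥ 0 for all n, and set X_{n+1} = S_{n+1} − S_n. Suppose there are constants b₁, b₂, c > 0, γ > 1/2 and N₀ ∈ ℕ such that for every n ≥ N₀: (1) E(X_{n+1}² + 2 X_{n+1} S_n | F_n) ≥ b₁ / n² almost surely; (2) E(X_{n+1} S_n 1_{S_n > c/n} | F_n) ≥ 0 almost surely; (3) |X_{n+1}| ≤ 1/(n+1)^γ almost surely; (4) E(X_{n+1}² | F_n) ≤ b₂ / n² almost surely. Then P(S_n → 0 as n → ∞)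 = 0. -/
open MeasureTheory Filter

lemma mul_measureReal_le_setIntegral {Ω : Type*} {m mΩ : MeasurableSpace Ω} {μ : Measure Ω}
    [IsFiniteMeasure μ] (hm : m ≤ mΩ) {f : Ω → ℝ} (hf : Integrable f μ) {b : ℝ}
    (hb : ∀ᵐ ω ∂μ, b ≤ (μ[f | m]) ω) {D : Set Ω} (hD : MeasurableSet[m] D) :
    b * μ.real D ≤ ∫ ω in D, f ω ∂μ := by
  rw [← setIntegral_condExp hm hf hD]
  calc b * μ.real D = ∫ ω in D, b ∂μ := by simp [mul_comm]
    _ ≤ _ := setIntegral_mono_ae (by simp) integrable_condExp.integrableOn hb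

lemma setIntegral_le_mul_measureReal {Ω : Type*} {m mΩ : MeasurableSpace Ω} {μ : Measure Ω}
    [IsFiniteMeasure μ] (hm : m ≤ mΩ) {f : Ω → ℝ} (hf : Integrable f μ) {b : ℝ}
    (hb : ∀ᵐ ω ∂μ, (μ[f | m]) ω ≤ b) {D : Set Ω} (hD : MeasurableSet[m] D) :
    ∫ ω in D, f ω ∂μ ≤ b * μ.real D := by
  rw [← setIntegral_condExp hm hf hD]
  calc _ ≤ ∫ ω in D, b ∂μ :=
        setIntegral_mono_ae integrable_condExp.integrableOn (by simp) hb
    _ = b * μ.real D := by simp [mul_comm]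

lemma setIntegral_mul_nonneg_of_condExp_nonneg {Ω : Type*} {m mΩ : MeasurableSpace Ω}
    {μ : Measure Ω} [IsFiniteMeasure μ] (hm : m ≤ mΩ) {f ψ : Ω → ℝ} (hf : Integrable f μ)
    (hf0 : ∀ᵐ ω ∂μ, 0 ≤ (μ[f | m]) ω) (hψ : Measurable[m] ψ) {C : ℝ} {E : Set Ω}
    (hE : MeasurableSet[m] E) (hψ0 : ∀ ω ∈ E, 0 ≤ ψ ω) (hψC : ∀ ω ∈ E, ψ ω ≤ C) :
    0 ≤ ∫ ω in E, ψ ω * f ω ∂μ := by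
  have hΨ : StronglyMeasurable[m] (E.indicator ψ) := (hψ.indicator hE).stronglyMeasurable
  have hΨ0 : ∀ ω, 0 ≤ E.indicator ψ ω := fun ω ↦ Set.indicator_nonneg hψ0 ω
  have hΨC : ∀ ω, ‖E.indicator ψ ω‖ ≤ |C| := fun ω ↦ by
    by_cases h : ω ∈ E
    · rw [Real.norm_of_nonneg (hΨ0 ω), Set.indicator_of_mem h]
      exact (hψC ω h).trans (le_abs_self C)
    · simp [h]
  have hint : Integrable (E.indicator ψ * f) μ :=
    hf.bdd_mul (hΨ.mono hm).aestronglyMeasurable (ae_of_all _ hΨC)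
  have key : ∫ ω in E, ψ ω * f ω ∂μ = ∫ ω, (E.indicator ψ * f) ω ∂μ := by
    rw [← integral_indicator (hm E hE)]
    refine integral_congr_ae (ae_of_all _ fun ω ↦ ?_)
    by_cases h : ω ∈ E <;> simp [h]
  rw [key, ← integral_condExp hm]
  refine integral_nonneg_of_ae ?_
  filter_upwards [condExp_mul_of_stronglyMeasurable_left hΨ hint hf, hf0] with ω h h0
  rw [h]
  exact mul_nonneg (hΨ0 ω) h0

/-- A form of Lévy's zero-one law. -/
lemma ae_eventually_notMem_of_measureReal_inter_le {Ω : Type*} {mΩ : MeasurableSpace Ω}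
    {μ : Measure Ω} [IsFiniteMeasure μ] (F : Filtration ℕ mΩ) {B : Set Ω}
    (hB : MeasurableSet[⨆ n, F n] B) {G : ℕ → Set Ω} (hG : ∀ n, MeasurableSet[F n] (G n))
    {q : ℝ} (hq : q < 1)
    (h : ∀ᶠ n in atTop, ∀ A, MeasurableSet[F n] A → A ⊆ G n → μ.real (A ∩ B) ≤ q * μ.real A) :
    ∀ᵐ ω ∂μ, ω ∈ B → ∀ᶠ n in atTop, ω ∉ G n := by
  have hB' : MeasurableSet B := (iSup_le fun n ↦ F.le n : (⨆ n, F n) ≤ mΩ) B hB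
  set g : Ω → ℝ := B.indicator fun _ ↦ 1 with hg
  have hgi : Integrable g μ := (integrable_const 1).indicator hB'
  have hbound : ∀ᶠ n in atTop, ∀ᵐ ω ∂μ, ω ∈ G n → (μ[g | F n]) ω ≤ q := by
    filter_upwards [h] with n hn
    have hcm : Measurable[F n] (μ[g | F n]) := stronglyMeasurable_condExp.measurable
    set A := G n ∩ {ω | q < (μ[g | F n]) ω} with hAdef
    have hA : MeasurableSet[F n] A := (hG n).inter (measurableSet_lt measurable_const hcm)
    have hle := hn A hA Set.inter_subset_left
    have hci : IntegrableOn (fun ω ↦ (μ[g | F n]) ω - q) A μ :=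
      (integrable_condExp.sub (integrable_const q)).integrableOn
    have hint : ∫ ω in A, ((μ[g | F n]) ω - q) ∂μ = μ.real (A ∩ B) - q * μ.real A := by
      rw [integral_sub integrable_condExp.integrableOn (by simp), setIntegral_condExp (F.le n) hgi hA,
        hg, setIntegral_indicator hB']
      simp [mul_comm]
    have hpos := setIntegral_pos_iff_support_of_nonneg_ae (μ := μ)
      ((ae_restrict_iff' (F.le n A hA)).2 (ae_of_all _ fun ω hω ↦ sub_nonneg.2 (le_of_lt hω.2))) hci
    have hzero : μ A = 0 := by
      by_contra h0
      have : 0 < ∫ ω in A, ((μ[g | F n]) ω - q) ∂μ := by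
        rw [hpos]
        refine (pos_iff_ne_zero.2 h0).trans_le (measure_mono fun ω hω ↦ ⟨?_, hω⟩)
        exact (sub_pos.2 hω.2).ne'
      linarith
    filter_upwards [measure_eq_zero_iff_ae_notMem.1 hzero] with ω hω hωG
    by_contra! hlt
    exact hω ⟨hωG, hlt⟩
  obtain ⟨N, hN⟩ := eventually_atTop.1 hbound
  have hN' : ∀ᵐ ω ∂μ, ∀ n, N ≤ n → ω ∈ G n → (μ[g | F n]) ω ≤ q := by
    rw [ae_all_iff]
    intro n
    by_cases hn : N ≤ n
    · filter_upwards [hN n hn] with ω hω _ using hω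
    · exact ae_of_all _ fun ω h ↦ absurd h hn
  have hgm : StronglyMeasurable[⨆ n, F n] g := stronglyMeasurable_const.indicator hB
  filter_upwards [hgi.tendsto_ae_condExp hgm, hN'] with ω hω hωN hωB
  rw [hg, Set.indicator_of_mem hωB] at hω
  filter_upwards [hω.eventually (lt_mem_nhds hq), eventually_ge_atTop N] with n h1 h2 h3
  exact absurd (hωN n h2 h3) (not_le.2 h1)

lemma integrable_sq_of_ae_abs_le {Ω : Type*} {mΩ : MeasurableSpace Ω} {μ : Measure Ω}
    [IsFiniteMeasure μ] {X : Ω → ℝ} (hX : Integrable X μ) {C : ℝ} (hC : ∀ᵐ ω ∂μ, |X ω| ≤ C) :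
    Integrable (fun ω ↦ X ω ^ 2) μ := by
  simp_rw [pow_two]
  exact hX.bdd_mul hX.aestronglyMeasurable hC

/-- A process whose square has conditional drift at least `b / k ^ 2` almost surely does not stay
below a barrier whose square is `e / k` forever, when `16 * e ≤ b`. -/
lemma measureReal_forall_lt_eq_zero {Ω : Type*} {mΩ : MeasurableSpace Ω} {μ : Measure Ω}
    [IsFiniteMeasure μ] (F : Filtration ℕ mΩ) {S : ℕ → Ω → ℝ} (hadapted : Adapted F S)
    (hint : ∀ n, Integrable (S n) μ) (hnonneg : ∀ n ω, 0 ≤ S n ω) {b e : ℝ} (he : 0 < e)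
    (hbe : 16 * e ≤ b) {ρ : ℕ → ℝ} {N : ℕ} (hN : 1 ≤ N)
    (hρ : ∀ k, N ≤ k → ρ k ^ 2 = e / k)
    (hdrift : ∀ n, N ≤ n → ∀ᵐ ω ∂μ, b / (n : ℝ) ^ 2 ≤
      (μ[(fun ω' ↦ (S (n + 1) ω' - S n ω') ^ 2 +
        2 * (S (n + 1) ω' - S n ω') * S n ω') | F n]) ω)
    (hstep : ∀ n, N ≤ n → ∀ᵐ ω ∂μ, |S (n + 1) ω - S n ω| ≤ ρ n) :
    μ.real {ω | ∀ k, N ≤ k → S k ω < ρ k} = 0 := by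
  set D : ℕ → Set Ω := fun k ↦ {ω | ∀ j, N ≤ j → j ≤ k → S j ω < ρ j} with hD
  set Dinf : Set Ω := {ω | ∀ k, N ≤ k → S k ω < ρ k} with hDinf
  have hDm : ∀ k, MeasurableSet[F k] (D k) := fun k ↦ by
    have : D k = ⋂ j, ⋂ (_ : N ≤ j), ⋂ (_ : j ≤ k), {ω | S j ω < ρ j} := by ext; simp [hD]
    rw [this]
    refine MeasurableSet.iInter fun j ↦ MeasurableSet.iInter fun _ ↦ MeasurableSet.iInter fun hj ↦ ?_
    exact measurableSet_lt ((hadapted j).mono (F.mono hj) le_rfl) measurable_const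
  have hDm' : ∀ k, MeasurableSet (D k) := fun k ↦ F.le k _ (hDm k)
  have hanti : Antitone D := fun k l hkl ω hω j hj hjk ↦ hω j hj (hjk.trans hkl)
  have hDI : Dinf = ⋂ k, D k := by
    ext ω
    simp only [hDinf, hD, Set.mem_iInter, Set.mem_ofPred_eq]
    exact ⟨fun h _ j hj _ ↦ h j hj, fun h k hk ↦ h k k hk le_rfl⟩
  have hSm : ∀ k, Measurable (S k) := fun k ↦ (hadapted k).mono (F.le k) le_rfl
  have hXi : ∀ k, Integrable (fun ω ↦ S (k + 1) ω - S k ω) μ := fun k ↦ (hint _).sub (hint _)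
  have hYi : ∀ k, N ≤ k → Integrable (fun ω ↦ (S (k + 1) ω - S k ω) ^ 2 +
      2 * (S (k + 1) ω - S k ω) * S k ω) μ := fun k hk ↦ by
    refine (integrable_sq_of_ae_abs_le (hXi k) (hstep k hk)).add ?_
    refine (hint k).bdd_mul (c := 2 * ρ k) ((hXi k).const_mul 2).aestronglyMeasurable ?_
    filter_upwards [hstep k hk] with ω hω
    rw [Real.norm_eq_abs, abs_mul, abs_two]
    linarith
  have hSi : ∀ k, N ≤ k → IntegrableOn (fun ω ↦ S k ω ^ 2) (D k) μ := fun k hk ↦ by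
    refine Measure.integrableOn_of_bounded (M := ρ k ^ 2) (measure_ne_top _ _)
      ((hSm k).pow_const 2).aestronglyMeasurable ?_
    refine (ae_restrict_iff' (hDm' k)).2 (ae_of_all _ fun ω hω ↦ ?_)
    rw [Real.norm_of_nonneg (sq_nonneg _)]
    exact pow_le_pow_left₀ (hnonneg k ω) (hω k hk le_rfl).le 2
  have hstep1 : ∀ k, N ≤ k → ∫ ω in D k, S k ω ^ 2 ∂μ + b / (k : ℝ) ^ 2 * μ.real (D k) ≤
      ∫ ω in D (k + 1), S (k + 1) ω ^ 2 ∂μ +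
        4 * e / k * (μ.real (D k) - μ.real (D (k + 1))) := fun k hk ↦ by
    have hsq : (fun ω ↦ S (k + 1) ω ^ 2) = fun ω ↦ S k ω ^ 2 + ((S (k + 1) ω - S k ω) ^ 2 +
        2 * (S (k + 1) ω - S k ω) * S k ω) := by ext; ring
    have hi : IntegrableOn (fun ω ↦ S (k + 1) ω ^ 2) (D k) μ := by
      rw [hsq]; exact (hSi k hk).add (hYi k hk).integrableOn
    have h1 : ∫ ω in D k, S (k + 1) ω ^ 2 ∂μ = ∫ ω in D k, S k ω ^ 2 ∂μ +
        ∫ ω in D k, ((S (k + 1) ω - S k ω) ^ 2 + 2 * (S (k + 1) ω - S k ω) * S k ω) ∂μ := by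
      rw [hsq]; exact integral_add (hSi k hk) (hYi k hk).integrableOn
    have h2 := mul_measureReal_le_setIntegral (F.le k) (hYi k hk) (hdrift k hk) (hDm k)
    have h3 := integral_inter_add_sdiff (hDm' (k + 1)) hi
    rw [Set.inter_eq_self_of_subset_right (hanti k.le_succ)] at h3
    have h4 : ∫ ω in D k \ D (k + 1), S (k + 1) ω ^ 2 ∂μ ≤
        4 * e / k * (μ.real (D k) - μ.real (D (k + 1))) := by
      rw [← measureReal_sdiff (hanti k.le_succ) (hDm' (k + 1))]
      calc _ ≤ ∫ ω in D k \ D (k + 1), 4 * e / k ∂μ := by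
            refine setIntegral_mono_on_ae (hi.mono_set Set.sdiff_subset) (by simp)
              ((hDm' k).diff (hDm' (k + 1))) ?_
            filter_upwards [hstep k hk] with ω hω hωD
            have h5 : S k ω < ρ k := hωD.1 k hk le_rfl
            have h6 : S (k + 1) ω ≤ 2 * ρ k := by linarith [(abs_le.1 hω).2]
            calc S (k + 1) ω ^ 2 ≤ (2 * ρ k) ^ 2 := pow_le_pow_left₀ (hnonneg _ _) h6 2
              _ = 4 * e / k := by rw [mul_pow, hρ k hk]; ring
        _ = _ := by simp [mul_comm]
    linarith
  have hδ : ∀ k, μ.real Dinf ≤ μ.real (D k) := fun k ↦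
    measureReal_mono (hDI ▸ Set.iInter_subset _ k)
  have hb : 0 < b := by linarith
  have hsum : ∀ n, N ≤ n → ∀ k, n ≤ k → b * (1 / (n : ℝ) - 1 / k) * μ.real Dinf ≤
      ∫ ω in D k, S k ω ^ 2 ∂μ + 4 * e / n * (μ.real (D n) - μ.real (D k)) := by
    intro n hn k hk
    induction k, hk using Nat.le_induction with
    | base => simpa using setIntegral_nonneg (hDm' n) fun ω _ ↦ sq_nonneg (S n ω)
    | succ k hk ih =>
      have hn0 : (0 : ℝ) < n := by exact_mod_cast hN.trans hn
      have hkn : (n : ℝ) ≤ k := by exact_mod_cast hk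
      have hk0 : (0 : ℝ) < k := hn0.trans_le hkn
      have h1 := hstep1 k (hn.trans hk)
      have h2 : b * (1 / (k : ℝ) - 1 / (k + 1 : ℕ)) * μ.real Dinf ≤
          b / (k : ℝ) ^ 2 * μ.real (D k) := by
        refine mul_le_mul ?_ (hδ k) measureReal_nonneg (by positivity)
        rw [div_eq_mul_one_div b]
        refine mul_le_mul_of_nonneg_left ?_ hb.le
        push_cast
        rw [div_sub_div _ _ hk0.ne' (by positivity), div_le_div_iff₀ (by positivity) (by positivity)]
        nlinarith
      have h3 : 4 * e / k * (μ.real (D k) - μ.real (D (k + 1))) ≤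
          4 * e / n * (μ.real (D k) - μ.real (D (k + 1))) :=
        mul_le_mul_of_nonneg_right (by gcongr)
          (sub_nonneg.2 (measureReal_mono (hanti k.le_succ)))
      linarith
  have hle : ∀ n, N ≤ n → μ.real Dinf ≤ 1 / 2 * μ.real (D n) := by
    intro n hn
    have hn0 : (0 : ℝ) < n := by exact_mod_cast hN.trans hn
    have h1 := hsum n hn (2 * n) (by lia)
    have h2 : ∫ ω in D (2 * n), S (2 * n) ω ^ 2 ∂μ ≤ 4 * e / n * μ.real (D (2 * n)) := by
      calc _ ≤ ∫ ω in D (2 * n), 4 * e / n ∂μ := by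
            refine setIntegral_mono_on (hSi _ (by lia)) (by simp) (hDm' _) fun ω hω ↦ ?_
            calc S (2 * n) ω ^ 2 ≤ ρ (2 * n) ^ 2 :=
                  pow_le_pow_left₀ (hnonneg _ _) (hω _ (by lia) le_rfl).le 2
              _ = e / (2 * n : ℕ) := hρ _ (by lia)
              _ ≤ 4 * e / n := by
                push_cast
                rw [div_le_div_iff₀ (by positivity) hn0]
                nlinarith [mul_pos he hn0]
        _ = _ := by simp [mul_comm]
    have h3 : b * (1 / (n : ℝ) - 1 / (2 * n : ℕ)) = b / 2 / n := by
      push_cast; field_simp; ring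
    rw [h3] at h1
    have h4 : b / 2 / n * μ.real Dinf ≤ 4 * e / n * μ.real (D n) := by linarith
    have h5 : b / 2 * μ.real Dinf ≤ 4 * e * μ.real (D n) := by
      have := mul_le_mul_of_nonneg_right h4 hn0.le
      field_simp at this ⊢
      linarith
    nlinarith [measureReal_nonneg (μ := μ) (s := Dinf), measureReal_nonneg (μ := μ) (s := D n)]
  have hlim : Tendsto (fun n ↦ μ.real (D n)) atTop (nhds (μ.real Dinf)) := by
    rw [hDI]
    exact (ENNReal.tendsto_toReal (measure_ne_top _ _)).comp
      (tendsto_measure_iInter_atTop (fun k ↦ (hDm' k).nullMeasurableSet) hanti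
        ⟨0, measure_ne_top _ _⟩)
  have := ge_of_tendsto (hlim.const_mul (1 / 2)) (eventually_atTop.2 ⟨N, hle⟩)
  linarith [measureReal_nonneg (μ := μ) (s := Dinf)]

lemma sq_max_sub_add_le (u x y : ℝ) :
    max (u - (x + y)) 0 ^ 2 ≤ max (u - x) 0 ^ 2 - 2 * (max (u - x) 0 * y) + y ^ 2 := by
  rcases max_cases (u - (x + y)) 0 with ⟨h, h'⟩ | ⟨h, h'⟩ <;>
    rcases max_cases (u - x) 0 with ⟨k, k'⟩ | ⟨k, k'⟩ <;> rw [h, k] <;>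
    nlinarith [sq_nonneg (u - x - y)]

/-- A process with nonnegative drift above level `r / 2` and summable conditional variances,
started above level `r`, tends to zero with conditional probability bounded by Cantelli's
inequality. -/
lemma measureReal_inter_tendsto_zero_le {Ω : Type*} {mΩ : MeasurableSpace Ω} {μ : Measure Ω}
    [IsFiniteMeasure μ] (F : Filtration ℕ mΩ) {S : ℕ → Ω → ℝ} (hadapted : Adapted F S)
    (hint : ∀ n, Integrable (S n) μ) (hnonneg : ∀ n ω, 0 ≤ S n ω) {b c r R : ℝ} (hb : 0 ≤ b)
    (hc : 0 ≤ c) (hr : 0 < r) (hR : 1 ≤ R) {m : ℕ} (hm : 1 ≤ m) (hcr : c / m < r / 2)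
    {C : ℕ → ℝ}
    (hdrift : ∀ n, m ≤ n → ∀ᵐ ω ∂μ, 0 ≤ (μ[(fun ω' ↦ if c / (n : ℝ) < S n ω' then
      (S (n + 1) ω' - S n ω') * S n ω' else 0) | F n]) ω)
    (hstep : ∀ n, m ≤ n → ∀ᵐ ω ∂μ, |S (n + 1) ω - S n ω| ≤ C n)
    (hvar : ∀ n, m ≤ n → ∀ᵐ ω ∂μ,
      (μ[(fun ω' ↦ (S (n + 1) ω' - S n ω') ^ 2) | F n]) ω ≤ b / (n : ℝ) ^ 2)
    {A : Set Ω} (hA : MeasurableSet[F m] A) (hAr : ∀ ω ∈ A, r ≤ S m ω) :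
    (R - 1 / 2) ^ 2 * r ^ 2 * μ.real (A ∩ {ω | Tendsto (fun n ↦ S n ω) atTop (nhds 0)}) ≤
      ((R - 1) ^ 2 * r ^ 2 + 2 * b / m) * μ.real A := by
  set E : ℕ → Set Ω := fun k ↦ A ∩ {ω | ∀ j, m ≤ j → j ≤ k → r / 2 ≤ S j ω} with hE
  set g : ℕ → Ω → ℝ := fun k ω ↦ max (R * r - S k ω) 0 ^ 2 with hg
  have hm0 : (0 : ℝ) < m := by exact_mod_cast hm
  have hEm : ∀ k, m ≤ k → MeasurableSet[F k] (E k) := fun k hk ↦ by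
    refine (F.mono hk A hA).inter ?_
    have : {ω | ∀ j, m ≤ j → j ≤ k → r / 2 ≤ S j ω} =
      ⋂ j, ⋂ (_ : m ≤ j), ⋂ (_ : j ≤ k), {ω | r / 2 ≤ S j ω} := by ext; simp
    rw [this]
    refine MeasurableSet.iInter fun j ↦ MeasurableSet.iInter fun _ ↦ MeasurableSet.iInter fun hj ↦ ?_
    exact measurableSet_le measurable_const ((hadapted j).mono (F.mono hj) le_rfl)
  have hEm' : ∀ k, m ≤ k → MeasurableSet (E k) := fun k hk ↦ F.le k _ (hEm k hk)
  have hanti : Antitone E := fun k l hkl ω hω ↦ ⟨hω.1, fun j hj hjk ↦ hω.2 j hj (hjk.trans hkl)⟩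
  have hSm : ∀ k, Measurable (S k) := fun k ↦ (hadapted k).mono (F.le k) le_rfl
  have hXi : ∀ k, Integrable (fun ω ↦ S (k + 1) ω - S k ω) μ := fun k ↦ (hint _).sub (hint _)
  have hgi : ∀ k, Integrable (g k) μ := fun k ↦ by
    refine Integrable.of_bound (C := (R * r) ^ 2)
      (((measurable_const.sub (hSm k)).max measurable_const).pow_const 2).aestronglyMeasurable
      (ae_of_all _ fun ω ↦ ?_)
    rw [Real.norm_of_nonneg (sq_nonneg _)]
    exact pow_le_pow_left₀ (le_max_right _ _)
      (max_le (by linarith [hnonneg k ω]) (by positivity)) 2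
  have hEA : ∀ k, μ.real (E k) ≤ μ.real A := fun k ↦ measureReal_mono Set.inter_subset_left
  have hdr : ∀ k, m ≤ k →
      0 ≤ ∫ ω in E k, max (R * r - S k ω) 0 * (S (k + 1) ω - S k ω) ∂μ := fun k hk ↦ by
    have hf : Integrable (fun ω' ↦ if c / (k : ℝ) < S k ω' then
        (S (k + 1) ω' - S k ω') * S k ω' else 0) μ := by
      have : Integrable (fun ω' ↦ (S (k + 1) ω' - S k ω') * S k ω') μ :=
        (hint k).bdd_mul (hXi k).aestronglyMeasurable (hstep k hk)
      exact this.indicator (measurableSet_lt measurable_const (hSm k))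
    have h := setIntegral_mul_nonneg_of_condExp_nonneg (F.le k) hf (hdrift k hk)
      (ψ := fun ω ↦ max (R * r - S k ω) 0 / S k ω) (C := R * r / (r / 2))
      (((measurable_const.sub (hadapted k)).max measurable_const).div (hadapted k)) (hEm k hk)
      (fun ω _ ↦ div_nonneg (le_max_right _ _) (hnonneg k ω))
      (fun ω hω ↦ div_le_div₀ (by positivity)
        (max_le (by linarith [hnonneg k ω]) (by positivity)) (by positivity) (hω.2 k hk le_rfl))
    refine h.trans_eq (setIntegral_congr_fun (hEm' k hk) fun ω hω ↦ ?_)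
    have h1 : r / 2 ≤ S k ω := hω.2 k hk le_rfl
    have h2 : c / k < S k ω := by
      have : c / (k : ℝ) ≤ c / m := by gcongr
      linarith
    have h3 : S k ω ≠ 0 := by linarith
    simp only [if_pos h2]
    field_simp
  have hstep1 : ∀ k, m ≤ k → ∫ ω in E (k + 1), g (k + 1) ω ∂μ +
      (R - 1 / 2) ^ 2 * r ^ 2 * (μ.real (E k) - μ.real (E (k + 1))) ≤
      ∫ ω in E k, g k ω ∂μ + b / (k : ℝ) ^ 2 * μ.real A := fun k hk ↦ by
    have hX2 := integrable_sq_of_ae_abs_le (hXi k) (hstep k hk)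
    have hmX : Integrable (fun ω ↦ max (R * r - S k ω) 0 * (S (k + 1) ω - S k ω)) μ := by
      refine (hXi k).bdd_mul (c := R * r)
        ((measurable_const.sub (hSm k)).max measurable_const).aestronglyMeasurable
        (ae_of_all _ fun ω ↦ ?_)
      rw [Real.norm_of_nonneg (le_max_right _ _)]
      exact max_le (by linarith [hnonneg k ω]) (by positivity)
    have hsub : Integrable
        (fun ω ↦ g k ω - 2 * (max (R * r - S k ω) 0 * (S (k + 1) ω - S k ω))) μ :=
      (hgi k).sub (hmX.const_mul 2)
    have h1 : ∫ ω in E k, g (k + 1) ω ∂μ ≤ ∫ ω in E k, g k ω ∂μ -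
        2 * ∫ ω in E k, max (R * r - S k ω) 0 * (S (k + 1) ω - S k ω) ∂μ +
        ∫ ω in E k, (S (k + 1) ω - S k ω) ^ 2 ∂μ := by
      rw [← integral_const_mul, ← integral_sub (hgi k).integrableOn (hmX.const_mul 2).integrableOn,
        ← integral_add hsub.integrableOn hX2.integrableOn]
      refine setIntegral_mono (hgi _).integrableOn
        (hsub.add hX2).integrableOn fun ω ↦ ?_
      have := sq_max_sub_add_le (R * r) (S k ω) (S (k + 1) ω - S k ω)
      rwa [add_sub_cancel] at this
    have h2 : ∫ ω in E k, (S (k + 1) ω - S k ω) ^ 2 ∂μ ≤ b / (k : ℝ) ^ 2 * μ.real A :=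
      (setIntegral_le_mul_measureReal (F.le k) hX2 (hvar k hk) (hEm k hk)).trans
        (mul_le_mul_of_nonneg_left (hEA k) (by positivity))
    have h3 := integral_inter_add_sdiff (hEm' (k + 1) (by lia)) ((hgi (k + 1)).integrableOn (s := E k))
    rw [Set.inter_eq_self_of_subset_right (hanti k.le_succ)] at h3
    have h4 : (R - 1 / 2) ^ 2 * r ^ 2 * (μ.real (E k) - μ.real (E (k + 1))) ≤
        ∫ ω in E k \ E (k + 1), g (k + 1) ω ∂μ := by
      rw [← measureReal_sdiff (hanti k.le_succ) (hEm' (k + 1) (by lia))]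
      calc _ = ∫ ω in E k \ E (k + 1), (R - 1 / 2) ^ 2 * r ^ 2 ∂μ := by simp [mul_comm]
        _ ≤ _ := by
          refine setIntegral_mono_on (integrable_const _).integrableOn (hgi _).integrableOn
            ((hEm' k hk).diff (hEm' (k + 1) (by lia))) fun ω hω ↦ ?_
          have h5 : S (k + 1) ω < r / 2 := by
            by_contra! h5
            refine hω.2 ⟨hω.1.1, fun j hj hjk ↦ ?_⟩
            rcases hjk.lt_or_eq with h6 | rfl
            · exact hω.1.2 j hj (by lia)
            · exact h5
          rw [← mul_pow]
          refine pow_le_pow_left₀ (mul_nonneg (by linarith) hr.le) (le_max_of_le_left ?_) 2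
          linarith
    linarith [hdr k hk]
  have hEmA : E m = A := by
    refine Set.inter_eq_self_of_subset_left fun ω hω j hj hjm ↦ ?_
    obtain rfl : j = m := le_antisymm hjm hj
    linarith [hAr ω hω]
  have hbase : ∫ ω in E m, g m ω ∂μ ≤ (R - 1) ^ 2 * r ^ 2 * μ.real A := by
    rw [hEmA]
    calc _ ≤ ∫ ω in A, (R - 1) ^ 2 * r ^ 2 ∂μ := by
          refine setIntegral_mono_on (hgi m).integrableOn (integrable_const _).integrableOn (F.le m A hA) fun ω hω ↦ ?_
          rw [← mul_pow]
          refine pow_le_pow_left₀ (le_max_right _ _) (max_le ?_ ?_) 2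
          · linarith [hAr ω hω]
          · exact mul_nonneg (by linarith) hr.le
      _ = _ := by simp [mul_comm]
  have hsum : ∀ k, m ≤ k → ∫ ω in E k, g k ω ∂μ +
      (R - 1 / 2) ^ 2 * r ^ 2 * (μ.real A - μ.real (E k)) ≤
      ((R - 1) ^ 2 * r ^ 2 + 2 * b * (1 / m - 1 / k)) * μ.real A := by
    intro k hk
    induction k, hk using Nat.le_induction with
    | base => rw [hEmA] at hbase ⊢; simpa using hbase
    | succ k hk ih =>
      have hk1 : (1 : ℝ) ≤ k := by exact_mod_cast hm.trans hk
      have hk0 : (0 : ℝ) < k := by linarith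
      have h1 := hstep1 k hk
      have h2 : b / (k : ℝ) ^ 2 * μ.real A ≤
          2 * b * (1 / (k : ℝ) - 1 / (k + 1 : ℕ)) * μ.real A := by
        refine mul_le_mul_of_nonneg_right ?_ measureReal_nonneg
        rw [div_eq_mul_one_div b, mul_comm 2 b, mul_assoc]
        refine mul_le_mul_of_nonneg_left ?_ hb
        push_cast
        rw [div_sub_div _ _ hk0.ne' (by positivity), mul_div_assoc',
          div_le_div_iff₀ (by positivity) (by positivity)]
        nlinarith
      linarith
  have hmain : ∀ k, m ≤ k → (R - 1 / 2) ^ 2 * r ^ 2 * μ.real (A \ E k) ≤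
      ((R - 1) ^ 2 * r ^ 2 + 2 * b / m) * μ.real A := fun k hk ↦ by
    rw [measureReal_sdiff Set.inter_subset_left (hEm' k hk)]
    have h1 := hsum k hk
    have h2 : 0 ≤ ∫ ω in E k, g k ω ∂μ := setIntegral_nonneg (hEm' k hk) fun ω _ ↦ sq_nonneg _
    have h3 : 0 ≤ 2 * b * (1 / (k : ℝ)) * μ.real A := by positivity
    have h4 : 2 * b / (m : ℝ) = 2 * b * (1 / m) := by ring
    rw [h4]
    linarith
  have hlim : Tendsto (fun k ↦ μ.real (A \ E k)) atTop (nhds (μ.real (⋃ k, A \ E k))) :=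
    (ENNReal.tendsto_toReal (measure_ne_top _ _)).comp
      (tendsto_measure_iUnion_atTop fun k l hkl ↦ Set.sdiff_subset_sdiff_right (hanti hkl))
  refine le_trans ?_ (le_of_tendsto (hlim.const_mul _) (eventually_atTop.2 ⟨m, hmain⟩))
  refine mul_le_mul_of_nonneg_left (measureReal_mono fun ω hω ↦ ?_) (by positivity)
  obtain ⟨k, hk, hkm⟩ := ((hω.2.eventually (gt_mem_nhds (half_pos hr))).and
    (eventually_ge_atTop m)).exists
  exact Set.mem_iUnion.2 ⟨k, hω.1, fun h ↦ (h.2 k hkm le_rfl).not_gt hk⟩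

/-- (Lemma `method`.)  Let `(S_n)` be a nonnegative adapted integrable
process with increments `X_{n+1} = S_{n+1} − S_n` satisfying, for all `n ≥ N₀`:
(1) `E(X_{n+1}² + 2 X_{n+1} S_n | F_n) ≥ b₁/n²` a.s.;
(2) `E(X_{n+1} S_n 1_{S_n > c/n} | F_n) ≥ 0` a.s.;
(3) `|X_{n+1}| ≤ 1/(n+1)^γ` a.s.;
(4) `E(X_{n+1}² | F_n) ≤ b₂/n²` a.s.
Then `P(S_n → 0) = 0`. -/
theorem stmt18 {Ω : Type} {mΩ : MeasurableSpace Ω} (μ : Measure Ω) [IsProbabilityMeasure μ]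
    (F : Filtration ℕ mΩ) (S : ℕ → Ω → ℝ)
    (hadapted : Adapted F S)
    (hint : ∀ n, Integrable (S n) μ)
    (hnonneg : ∀ n ω, 0 ≤ S n ω)
    (b₁ b₂ c γ : ℝ) (hb₁ : 0 < b₁) (hb₂ : 0 < b₂) (hc : 0 < c) (hγ : 1 / 2 < γ)
    (N₀ : ℕ)
    (h1 : ∀ n, N₀ ≤ n → ∀ᵐ ω ∂μ,
      b₁ / (n : ℝ) ^ 2 ≤
        (μ[(fun ω' => (S (n + 1) ω' - S n ω') ^ 2 +
            2 * (S (n + 1) ω' - S n ω') * S n ω') | F n]) ω)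
    (h2 : ∀ n, N₀ ≤ n → ∀ᵐ ω ∂μ,
      0 ≤ (μ[(fun ω' => if c / (n : ℝ) < S n ω' then
            (S (n + 1) ω' - S n ω') * S n ω' else 0) | F n]) ω)
    (h3 : ∀ n, N₀ ≤ n → ∀ᵐ ω ∂μ,
      |S (n + 1) ω - S n ω| ≤ 1 / ((n : ℝ) + 1) ^ γ)
    (h4 : ∀ n, N₀ ≤ n → ∀ᵐ ω ∂μ,
      (μ[(fun ω' => (S (n + 1) ω' - S n ω') ^ 2) | F n]) ω ≤ b₂ / (n : ℝ) ^ 2) :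
    μ {ω | Tendsto (fun n => S n ω) atTop (nhds 0)} = 0 := by
  have he : 0 < b₁ / 16 := by positivity
  set e : ℝ := b₁ / 16 with he_def
  set ρ : ℕ → ℝ := fun k ↦ √(e / k) with hρ_def
  have hρ : ∀ k, ρ k ^ 2 = e / k := fun k ↦ Real.sq_sqrt (by positivity)
  have hjump : ∀ᶠ k : ℕ in atTop, 1 / ((k : ℝ) + 1) ^ γ ≤ ρ k := by
    have hlim : Tendsto (fun k : ℕ ↦ ((k : ℝ) + 1) ^ (-(2 * γ - 1))) atTop (nhds 0) :=
      (tendsto_rpow_neg_atTop (by linarith)).comp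
        (tendsto_atTop_add_const_right _ _ tendsto_natCast_atTop_atTop)
    filter_upwards [hlim.eventually (gt_mem_nhds he), eventually_ge_atTop 1] with k hk hk1
    have hk0 : (0 : ℝ) < k := by exact_mod_cast hk1
    have hk2 : (0 : ℝ) < (k : ℝ) + 1 := by positivity
    refine Real.le_sqrt_of_sq_le ?_
    have h5 : (1 / ((k : ℝ) + 1) ^ γ) ^ 2 * ((k : ℝ) + 1) = ((k : ℝ) + 1) ^ (-(2 * γ - 1)) := by
      rw [one_div, ← Real.rpow_neg hk2.le, ← Real.rpow_natCast, ← Real.rpow_mul hk2.le,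
        ← Real.rpow_add_one hk2.ne']
      congr 1
      push_cast
      ring
    rw [le_div_iff₀ hk0]
    nlinarith [sq_nonneg (1 / ((k : ℝ) + 1) ^ γ)]
  have hcρ : ∀ᶠ k : ℕ in atTop, c / k < ρ k / 2 := by
    filter_upwards [(tendsto_natCast_atTop_atTop (R := ℝ)).eventually_gt_atTop (4 * c ^ 2 / e),
      eventually_ge_atTop 1] with k hk hk1
    have hk0 : (0 : ℝ) < k := by exact_mod_cast hk1
    have h5 : 2 * (c / k) < ρ k := by
      refine Real.lt_sqrt_of_sq_lt ?_
      rw [div_lt_iff₀ he] at hk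
      rw [mul_pow, div_pow, mul_div_assoc', div_lt_div_iff₀ (by positivity) hk0]
      nlinarith
    linarith
  obtain ⟨N, hN⟩ := eventually_atTop.1
    ((hjump.and hcρ).and ((eventually_ge_atTop 1).and (eventually_ge_atTop N₀)))
  have hstep : ∀ n, N ≤ n → ∀ᵐ ω ∂μ, |S (n + 1) ω - S n ω| ≤ ρ n := fun n hn ↦ by
    filter_upwards [h3 n (hN n hn).2.2] with ω hω using hω.trans (hN n hn).1.1
  have hescape : ∀ᵐ ω ∂μ, ∀ n, N ≤ n → ¬ ∀ k, n ≤ k → S k ω < ρ k := by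
    rw [ae_all_iff]
    intro n
    by_cases hn : N ≤ n
    · have h5 := measureReal_forall_lt_eq_zero F hadapted hint hnonneg he
        (show 16 * e ≤ b₁ by linarith) (hN n hn).2.1 (fun k _ ↦ hρ k)
        (fun k hk ↦ h1 k ((hN n hn).2.2.trans hk)) (fun k hk ↦ hstep k (hn.trans hk))
      rw [measureReal_eq_zero_iff] at h5
      filter_upwards [measure_eq_zero_iff_ae_notMem.1 h5] with ω hω _ using hω
    · exact ae_of_all _ fun ω h ↦ absurd h hn
  set B : Set Ω := {ω | Tendsto (fun n ↦ S n ω) atTop (nhds 0)} with hB_def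
  have hB : MeasurableSet[⨆ n, F n] B :=
    measurableSet_tendsto _ fun n ↦ (hadapted n).mono (le_iSup (fun n ↦ (F n : MeasurableSpace Ω)) n) le_rfl
  set K : ℝ := 2 * b₂ / e with hK_def
  have hK : 0 < K := by positivity
  have hlevy := ae_eventually_notMem_of_measureReal_inter_le (μ := μ) F hB
    (G := fun n ↦ {ω | ρ n ≤ S n ω}) (q := (K ^ 2 + K) / (K ^ 2 + K + 1 / 4))
    (fun n ↦ measurableSet_le measurable_const (hadapted n))
    (by rw [div_lt_one (by positivity)]; linarith)
    (eventually_atTop.2 ⟨N, fun n hn A hA hAG ↦ by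
      have hn0 : (0 : ℝ) < n := by exact_mod_cast (hN n hn).2.1
      have hr : 0 < ρ n := Real.sqrt_pos.2 (by positivity)
      have h5 := measureReal_inter_tendsto_zero_le F hadapted hint hnonneg hb₂.le hc.le hr
        (show 1 ≤ K + 1 by linarith) (hN n hn).2.1 (hN n hn).1.2
        (fun k hk ↦ h2 k ((hN n hn).2.2.trans hk)) (fun k hk ↦ hstep k (hn.trans hk))
        (fun k hk ↦ h4 k ((hN n hn).2.2.trans hk)) hA hAG
      have h6 : 2 * b₂ / n = K * ρ n ^ 2 := by
        rw [hρ, hK_def]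
        field_simp
      rw [h6] at h5
      rw [div_mul_eq_mul_div, le_div_iff₀ (by positivity)]
      refine le_of_mul_le_mul_right ?_ (pow_pos hr 2)
      linarith⟩)
  rw [measure_eq_zero_iff_ae_notMem]
  filter_upwards [hescape, hlevy] with ω hω hωB hB
  obtain ⟨n, hn⟩ := eventually_atTop.1 (hωB hB)
  exact hω (max n N) (le_max_right _ _) fun k hk ↦ not_le.1 (hn k ((le_max_left _ _).trans hk))
end
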